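/- Let A be a {0,1}-valued random variable with 0 < P(A=1) < 1, and suppose that conditionally on A=a, X is Gaussian N(μ_a, σ_X²) with μ_0 ≠ μ_1 and σ_X > 0. Let W be a standard Gaussian independent of (A, X), let β ≠ 0, σ > 0, and set Y = β·X + σ·W. Then X and A are NOT conditionally independent given Y; that is, the prediction R = X fails Separation. -/

import Mathlib

open MeasureTheory ProbabilityTheory
open scoped ENNReal NNReal

/-- The ratio `f₁ / f₀` of Gaussian densities with equal variance and distinct means is
injective. -/
lemma eq_of_gaussianPDFReal_mul_eq {m₀ m₁ : ℝ} (hm : m₀ ≠ m₁) {v : ℝ≥0} (hv : v ≠ 0) {x y : ℝ}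
    (h : gaussianPDFReal m₁ v x * gaussianPDFReal m₀ v y =
      gaussianPDFReal m₁ v y * gaussianPDFReal m₀ v x) : x = y := by
  have hv' : (0 : ℝ) < v := by exact_mod_cast pos_iff_ne_zero.mpr hv
  have hc : (√(2 * Real.pi * v))⁻¹ ≠ 0 := by positivity
  simp only [gaussianPDFReal] at h
  rw [mul_mul_mul_comm, mul_mul_mul_comm _ _ _ (Real.exp (-(x - m₀) ^ 2 / (2 * v))),
    mul_right_inj' (mul_ne_zero hc hc), ← Real.exp_add, ← Real.exp_add,
    Real.exp_injective.eq_iff] at h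
  field_simp at h
  have : (m₁ - m₀) * (x - y) = 0 := by linarith
  rcases mul_eq_zero.mp this with h' | h'
  · exact absurd (sub_eq_zero.mp h').symm hm
  · exact sub_eq_zero.mp h'

/-- The posterior weight of the second component in a two-component mixture of densities
`p * f` and `q * g`. -/
noncomputable def posteriorWeight (p q : ℝ) (f g : ℝ → ℝ) (x : ℝ) : ℝ :=
  q * g x / (p * f x + q * g x)

lemma posteriorWeight_gaussian_injective {p q : ℝ} (hp : 0 < p) (hq : 0 < q) {m₀ m₁ : ℝ}
    (hm : m₀ ≠ m₁) {v : ℝ≥0} (hv : v ≠ 0) :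
    Function.Injective
      (posteriorWeight p q (gaussianPDFReal m₀ v) (gaussianPDFReal m₁ v)) := by
  intro x y h
  have hx₀ := gaussianPDFReal_pos m₀ v x hv
  have hx₁ := gaussianPDFReal_pos m₁ v x hv
  have hy₀ := gaussianPDFReal_pos m₀ v y hv
  have hy₁ := gaussianPDFReal_pos m₁ v y hv
  rw [posteriorWeight, posteriorWeight, div_eq_div_iff (by positivity) (by positivity)] at h
  refine eq_of_gaussianPDFReal_mul_eq hm hv (mul_left_cancel₀ (mul_pos hp hq).ne' ?_)
  linarith

/-- If `X` and `A` are conditionally independent given `Y`, then the joint law of `(Y, X)` on the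
event `A = a` has a density with respect to the joint law of `(Y, X)` depending only on `Y`. -/
lemma CondIndepFun.exists_measure_inter_eq_setLIntegral {Ω α β γ : Type*} [MeasurableSpace Ω]
    [StandardBorelSpace Ω] [MeasurableSpace α] [StandardBorelSpace α] [Nonempty α]
    [MeasurableSpace β] [StandardBorelSpace β] [Nonempty β] [MeasurableSpace γ]
    {μ : Measure Ω} [IsFiniteMeasure μ] {A : Ω → α} {X : Ω → β} {Y : Ω → γ}
    (hA : Measurable A) (hX : Measurable X) (hY : Measurable Y)
    (h : CondIndepFun (MeasurableSpace.comap Y inferInstance) hY.comap_le X A μ)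
    {s : Set α} (hs : MeasurableSet s) :
    ∃ κ : γ → ℝ≥0∞, Measurable κ ∧ ∀ B : Set (γ × β), MeasurableSet B →
      μ ((fun ω ↦ (Y ω, X ω)) ⁻¹' B ∩ A ⁻¹' s) =
        ∫⁻ ω in (fun ω ↦ (Y ω, X ω)) ⁻¹' B, κ (Y ω) ∂μ := by
  refine ⟨fun y ↦ condDistrib A Y μ y s, Kernel.measurable_coe _ hs, fun B hB ↦ ?_⟩
  rw [condIndepFun_iff_condDistrib_prod_ae_eq_prodMkRight hA hX hY,
    condDistrib_ae_eq_iff_measure_eq_compProd _ hA.aemeasurable] at h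
  have h' := congrArg (fun ν ↦ ν (B ×ˢ s)) h
  simp only [Measure.compProd_apply_prod hB hs] at h'
  rw [Measure.map_apply (by fun_prop) (hB.prod hs),
    setLIntegral_map hB (Kernel.measurable_coe _ hs) (by fun_prop)] at h'
  exact h'

/-- If `W` is independent of `(A, X)`, then on each event `A ∈ s` the joint law of `(X, W)` is a
product. -/
lemma IndepFun.map_restrict_prodMk {Ω α β γ : Type*} [MeasurableSpace Ω] [MeasurableSpace α]
    [MeasurableSpace β] [MeasurableSpace γ] {μ : Measure Ω} [IsFiniteMeasure μ]
    {A : Ω → α} {X : Ω → β} {W : Ω → γ}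
    (hX : Measurable X) (hW : Measurable W)
    (h : IndepFun W (fun ω ↦ (A ω, X ω)) μ) {s : Set α} (hs : MeasurableSet s) :
    (μ.restrict (A ⁻¹' s)).map (fun ω ↦ (X ω, W ω)) =
      ((μ.restrict (A ⁻¹' s)).map X).prod (μ.map W) := by
  refine (Measure.prod_eq fun t u ht hu ↦ ?_).symm
  have := h.measure_inter_preimage_eq_mul u (s ×ˢ t) hu (hs.prod ht)
  rw [Measure.map_apply (by fun_prop) (ht.prod hu), Measure.map_apply hX ht,
    Measure.map_apply hW hu, Measure.restrict_apply (hX ht),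
    Measure.restrict_apply ((hX.prodMk hW) (ht.prod hu)), mul_comm]
  convert this using 2
  · ext ω; simp; tauto
  · congr 1; ext ω; simp; tauto

/-- A function of the form `κ (a + σ * w)` that is constant for Gaussian-almost every `w` is
almost everywhere constant. -/
lemma ae_eq_const_of_ae_gaussianReal_affine {κ : ℝ → ℝ≥0∞} (hκ : Measurable κ) {a σ : ℝ}
    (hσ : σ ≠ 0) {c : ℝ≥0∞} (h : ∀ᵐ w ∂gaussianReal 0 1, c = κ (a + σ * w)) :
    ∀ᵐ y : ℝ, c = κ y := by
  have hmap : (gaussianReal 0 1).map (fun w ↦ a + σ * w) =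
      gaussianReal a (.mk (σ ^ 2) (sq_nonneg σ)) := by
    have := Measure.map_map (μ := gaussianReal 0 1) (measurable_const_add a)
      (measurable_const_mul σ)
    rw [gaussianReal_map_const_mul, gaussianReal_map_const_add] at this
    simpa [Function.comp_def] using this.symm
  have hv : (.mk (σ ^ 2) (sq_nonneg σ) : ℝ≥0) ≠ 0 := by
    intro h0
    exact pow_ne_zero 2 hσ (congrArg NNReal.toReal h0)
  refine (gaussianReal_absolutelyContinuous' a hv).ae_le ?_
  rw [← hmap]
  exact (ae_map_iff (by fun_prop) (measurableSet_eq_fun measurable_const hκ)).mpr h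

lemma map_restrict_eq_smul_map_cond {Ω α : Type*} [MeasurableSpace Ω] [MeasurableSpace α]
    {μ : Measure Ω} [IsFiniteMeasure μ] {s : Set Ω} (hs : μ s ≠ 0) (X : Ω → α) :
    (μ.restrict s).map X = μ s • (μ[|s]).map X := by
  rw [ProbabilityTheory.cond, Measure.map_smul, smul_smul,
    ENNReal.mul_inv_cancel hs (measure_ne_top μ s), one_smul]

lemma smul_gaussianReal_eq_withDensity {c : ℝ≥0∞} (hc : c ≠ ∞) (m : ℝ) {v : ℝ≥0} (hv : v ≠ 0) :
    c • gaussianReal m v =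
      volume.withDensity (fun x ↦ ENNReal.ofReal (c.toReal * gaussianPDFReal m v x)) := by
  rw [gaussianReal_of_var_ne_zero m hv, ← withDensity_smul _ (measurable_gaussianPDF m v)]
  congr 1
  ext x
  rw [Pi.smul_apply, smul_eq_mul, gaussianPDF, ENNReal.ofReal_mul ENNReal.toReal_nonneg,
    ENNReal.ofReal_toReal hc]

/-- The second component of a mixture has density `posteriorWeight` with respect to the
mixture. -/
lemma withDensity_mixture_posteriorWeight (ν : Measure ℝ)
    {p q : ℝ} (hp : 0 < p) (hq : 0 < q) {f g : ℝ → ℝ} (hf : Measurable f) (hg : Measurable g)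
    (hf₀ : ∀ x, 0 < f x) (hg₀ : ∀ x, 0 < g x) :
    (ν.withDensity (fun x ↦ ENNReal.ofReal (p * f x)) +
        ν.withDensity (fun x ↦ ENNReal.ofReal (q * g x))).withDensity
        (fun x ↦ ENNReal.ofReal (posteriorWeight p q f g x)) =
      ν.withDensity (fun x ↦ ENNReal.ofReal (q * g x)) := by
  have hw : Measurable (fun x ↦ ENNReal.ofReal (posteriorWeight p q f g x)) := by
    unfold posteriorWeight; fun_prop
  rw [← withDensity_add_left (by fun_prop), ← withDensity_mul _ (by fun_prop) hw]
  congr 1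
  ext x
  have h₁ := mul_pos hp (hf₀ x)
  have h₂ := mul_pos hq (hg₀ x)
  simp only [Pi.mul_apply, Pi.add_apply]
  rw [← ENNReal.ofReal_add h₁.le h₂.le, ← ENNReal.ofReal_mul (by positivity), posteriorWeight,
    mul_div_cancel₀ _ (by positivity)]

/-- **Failure of Separation for the raw feature in a Gaussian model.**
`A` is `{0,1}`-valued (modelled as `Bool`-valued, `true = 1`) with `0 < P(A = 1) < 1`, the
conditional law of `X` given `A = a` is `N(μ_a, σ_X²)` with `μ_0 ≠ μ_1`, `W` is a standard
Gaussian independent of `(A, X)`, and `Y = β·X + σ·W`. Then `X` and `A` are NOT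
conditionally independent given `Y`: the prediction `R = X` fails Separation. -/
theorem raw_feature_fails_separation
    {Ω : Type*} [MeasurableSpace Ω] [StandardBorelSpace Ω] [Nonempty Ω]
    (μ : Measure Ω) [IsProbabilityMeasure μ]
    (A : Ω → Bool) (hA : Measurable A)
    (hA1 : 0 < μ {ω | A ω = true}) (hA1' : μ {ω | A ω = true} < 1)
    (X : Ω → ℝ) (hX : Measurable X)
    (μf : Bool → ℝ) (hμf : μf false ≠ μf true) (σX : ℝ) (hσX : 0 < σX)
    (hXlaw : ∀ a : Bool, (μ[|{ω | A ω = a}]).map X = gaussianReal (μf a) ((σX ^ 2).toNNReal))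
    (W : Ω → ℝ) (hWmeas : Measurable W)
    (hWlaw : μ.map W = gaussianReal 0 1)
    (hWindep : IndepFun W (fun ω => (A ω, X ω)) μ)
    (β σ : ℝ) (hβ : β ≠ 0) (hσ : 0 < σ)
    (Y : Ω → ℝ) (hY : Y = fun ω => β * X ω + σ * W ω) (hYm : Measurable Y) :
    ¬ CondIndepFun (MeasurableSpace.comap Y inferInstance) hYm.comap_le X A μ := by
  intro hCI
  have hv : (σX ^ 2).toNNReal ≠ 0 := (Real.toNNReal_pos.mpr (by positivity)).ne'
  have hmeasA (a : Bool) : MeasurableSet (A ⁻¹' {a}) := hA (measurableSet_singleton a)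
  have hcompl : A ⁻¹' {false} = (A ⁻¹' {true})ᶜ := by ext ω; simp
  have hpos (a : Bool) : μ (A ⁻¹' {a}) ≠ 0 := by
    cases a
    · rw [hcompl, prob_compl_eq_one_sub (hmeasA true)]
      exact (tsub_pos_of_lt hA1').ne'
    · exact hA1.ne'
  have hposR (a : Bool) : 0 < (μ (A ⁻¹' {a})).toReal :=
    ENNReal.toReal_pos (hpos a) (measure_ne_top _ _)
  let f (a : Bool) : ℝ → ℝ := gaussianPDFReal (μf a) (σX ^ 2).toNNReal
  let w : ℝ → ℝ := posteriorWeight (μ (A ⁻¹' {false})).toReal (μ (A ⁻¹' {true})).toReal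
    (f false) (f true)
  have hw : Measurable (fun x ↦ ENNReal.ofReal (w x)) := by
    unfold w posteriorWeight f; fun_prop
  have hlaw (a : Bool) : (μ.restrict (A ⁻¹' {a})).map X = volume.withDensity
      (fun x ↦ ENNReal.ofReal ((μ (A ⁻¹' {a})).toReal * f a x)) := by
    rw [map_restrict_eq_smul_map_cond (hpos a),
      ← smul_gaussianReal_eq_withDensity (measure_ne_top _ _) _ hv, ← hXlaw a]
    rfl
  have hlawX : μ.map X = (μ.restrict (A ⁻¹' {false})).map X +
      (μ.restrict (A ⁻¹' {true})).map X := by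
    rw [← Measure.map_add _ _ hX, hcompl, add_comm, Measure.restrict_add_restrict_compl (hmeasA _)]
  have hdens : (μ.restrict (A ⁻¹' {true})).map X =
      (μ.map X).withDensity (fun x ↦ ENNReal.ofReal (w x)) := by
    rw [hlawX, hlaw, hlaw]
    exact (withDensity_mixture_posteriorWeight volume (hposR false) (hposR true)
      (measurable_gaussianPDFReal _ _) (measurable_gaussianPDFReal _ _)
      (fun x ↦ gaussianPDFReal_pos _ _ x hv) (fun x ↦ gaussianPDFReal_pos _ _ x hv)).symm
  have hXW : μ.map (fun ω ↦ (X ω, W ω)) = (μ.map X).prod (gaussianReal 0 1) := by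
    rw [← hWlaw]
    exact (indepFun_iff_map_prod_eq_prod_map_map hX.aemeasurable hWmeas.aemeasurable).mp
      (hWindep.comp measurable_id measurable_snd).symm
  obtain ⟨κ, hκ, hCIκ⟩ :=
    CondIndepFun.exists_measure_inter_eq_setLIntegral hA hX hYm hCI (measurableSet_singleton true)
  have : IsProbabilityMeasure (μ.map X) := Measure.isProbabilityMeasure_map hX.aemeasurable
  have hwκ : (fun p : ℝ × ℝ ↦ ENNReal.ofReal (w p.1))
      =ᵐ[(μ.map X).prod (gaussianReal 0 1)] fun p ↦ κ (β * p.1 + σ * p.2) := by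
    have hκ' : Measurable (fun p : ℝ × ℝ ↦ κ (β * p.1 + σ * p.2)) := by fun_prop
    have hw' : Measurable (fun p : ℝ × ℝ ↦ ENNReal.ofReal (w p.1)) := hw.comp measurable_fst
    have heq : ((μ.map X).prod (gaussianReal 0 1)).withDensity
          (fun p : ℝ × ℝ ↦ ENNReal.ofReal (w p.1)) =
        ((μ.map X).prod (gaussianReal 0 1)).withDensity
          (fun p : ℝ × ℝ ↦ κ (β * p.1 + σ * p.2)) := by
      rw [← prod_withDensity_left hw, ← hdens, ← hXW, ← hWlaw,
        ← IndepFun.map_restrict_prodMk hX hWmeas hWindep (measurableSet_singleton true)]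
      ext C hC
      have hB : MeasurableSet ((fun p : ℝ × ℝ ↦ (p.2, (p.1 - β * p.2) / σ)) ⁻¹' C) :=
        (by fun_prop : Measurable fun p : ℝ × ℝ ↦ (p.2, (p.1 - β * p.2) / σ)) hC
      have hpre : (fun ω ↦ (Y ω, X ω)) ⁻¹' ((fun p : ℝ × ℝ ↦ (p.2, (p.1 - β * p.2) / σ)) ⁻¹' C) =
          (fun ω ↦ (X ω, W ω)) ⁻¹' C := by
        ext ω
        simp [hY, hσ.ne']
      have hXWm : Measurable (fun ω ↦ (X ω, W ω)) := hX.prodMk hWmeas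
      rw [Measure.map_apply hXWm hC, Measure.restrict_apply (hXWm hC), withDensity_apply _ hC,
        setLIntegral_map hC hκ' hXWm, ← hpre, hCIκ _ hB]
      simp only [hY]
    refine (withDensity_eq_iff_of_sigmaFinite hw'.aemeasurable hκ'.aemeasurable).mp heq
  have hconst : ∀ᵐ x ∂μ.map X, ∀ᵐ y : ℝ, ENNReal.ofReal (w x) = κ y := by
    filter_upwards [Measure.ae_ae_of_ae_prod hwκ] with x hx
    exact ae_eq_const_of_ae_gaussianReal_affine hκ hσ.ne' hx
  have hatom (x : ℝ) : ∀ᵐ x' ∂μ.map X, x' ≠ x := by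
    rw [hlawX, hlaw, hlaw, ae_add_measure_iff]
    exact ⟨(withDensity_absolutelyContinuous _ _).ae_le (Measure.ae_ne volume x),
      (withDensity_absolutelyContinuous _ _).ae_le (Measure.ae_ne volume x)⟩
  obtain ⟨x, hx⟩ := hconst.exists
  obtain ⟨x', hx', hne⟩ := (hconst.and (hatom x)).exists
  obtain ⟨y, hy, hy'⟩ := (hx.and hx').exists
  have hw₀ (x : ℝ) : 0 ≤ w x := by
    have h₀ := mul_pos (hposR false) (gaussianPDFReal_pos (μf false) _ x hv)
    have h₁ := mul_pos (hposR true) (gaussianPDFReal_pos (μf true) _ x hv)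
    exact div_nonneg h₁.le (add_pos h₀ h₁).le
  have hww : w x' = w x :=
    (ENNReal.ofReal_eq_ofReal_iff (hw₀ x') (hw₀ x)).mp (hy'.trans hy.symm)
  exact hne (posteriorWeight_gaussian_injective (hposR false) (hposR true) hμf hv hww)
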